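/- The matrix H_toy(0,0) realizes a sixth-order exceptional point of minimal geometric multiplicity K = 1: there exists an invertible 6×6 complex matrix Q such that Q⁻¹ · H_toy(0,0) · Q = J^{(6)}(0), the single 6×6 Jordan block with eigenvalue 0. Equivalently, H_toy(0,0) is nilpotent with H_toy(0,0)^6 = 0 and H_toy(0,0)^5 ≠ 0. -/

import Mathlib

open Matrix Polynomial

/-- The `6 × 6` real matrix `H_toy(g,λ)`: diagonal `(−5+g, −3, −1, 1, 3, 5−g)`,
superdiagonal `(√(5+5λ), 2√(2+2λ), 3√(1+λ), 2√(2+2λ), √(5+5λ))`, subdiagonal the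
negatives of the corresponding superdiagonal entries, all other entries zero. -/
noncomputable def Htoy (g lam : ℝ) : Matrix (Fin 6) (Fin 6) ℝ :=
  !![-5+g, Real.sqrt (5+5*lam), 0, 0, 0, 0;
     -Real.sqrt (5+5*lam), -3, 2*Real.sqrt (2+2*lam), 0, 0, 0;
     0, -(2*Real.sqrt (2+2*lam)), -1, 3*Real.sqrt (1+lam), 0, 0;
     0, 0, -(3*Real.sqrt (1+lam)), 1, 2*Real.sqrt (2+2*lam), 0;
     0, 0, 0, -(2*Real.sqrt (2+2*lam)), 3, Real.sqrt (5+5*lam);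
     0, 0, 0, 0, -Real.sqrt (5+5*lam), 5-g]

/-- The `m × m` Jordan block `J^{(m)}(η)`: `η` on the diagonal, `1` on the
superdiagonal, `0` elsewhere. -/
def jordanBlock (m : ℕ) (η : ℂ) : Matrix (Fin m) (Fin m) ℂ :=
  Matrix.of fun k l => if k = l then η else if (k : ℕ) + 1 = (l : ℕ) then 1 else 0
/-- The integer matrix to which `Htoy 0 0` is conjugate under the diagonal matrix of the
square roots of the binomial coefficients `5.choose k`. -/
def toyInt : Matrix (Fin 6) (Fin 6) ℤ :=
  !![-5, 5, 0, 0, 0, 0;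
     -1, -3, 4, 0, 0, 0;
     0, -2, -1, 3, 0, 0;
     0, 0, -3, 1, 2, 0;
     0, 0, 0, -4, 3, 1;
     0, 0, 0, 0, -5, 5]

/-- The integer Jordan chain matrix of `toyInt`, with columns `toyInt ^ (5 - j) e₀`. -/
def toyChain : Matrix (Fin 6) (Fin 6) ℤ :=
  !![-120, 120, -60, 20, -5, 1;
     -120, 96, -36, 8, -1, 0;
     -120, 72, -18, 2, 0, 0;
     -120, 48, -6, 0, 0, 0;
     -120, 24, 0, 0, 0, 0;
     -120, 0, 0, 0, 0, 0]

/-- `120` times the inverse of `toyChain`. -/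
def toyChainAdj : Matrix (Fin 6) (Fin 6) ℤ :=
  !![0, 0, 0, 0, 0, -1;
     0, 0, 0, 0, 5, -5;
     0, 0, 0, -20, 40, -20;
     0, 0, 60, -180, 180, -60;
     0, -120, 480, -720, 480, -120;
     120, -600, 1200, -1200, 600, -120]

/-- The nilpotent `6 × 6` Jordan block with integer entries. -/
def jordanInt : Matrix (Fin 6) (Fin 6) ℤ :=
  Matrix.of fun k l => if (k : ℕ) + 1 = (l : ℕ) then 1 else 0

/-- The square roots of the binomial coefficients `5.choose k`. -/
noncomputable def sqrtBinom : Fin 6 → ℝ :=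
  ![1, √5, √5 * √2, √5 * √2, √5, 1]

lemma toyInt_mul_toyChain : toyInt * toyChain = toyChain * jordanInt := by
  decide +kernel

lemma toyChain_mul_toyChainAdj : toyChain * toyChainAdj = (120 : ℤ) • 1 := by
  decide +kernel

lemma toyInt_pow_six : toyInt ^ 6 = 0 := by
  decide +kernel

lemma toyInt_pow_five : toyInt ^ 5 ≠ 0 := by
  decide +kernel

lemma isUnit_map_toyChain : IsUnit ((Int.castRingHom ℝ).mapMatrix toyChain) := by
  have h := congrArg (Int.castRingHom ℝ).mapMatrix toyChain_mul_toyChainAdj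
  rw [map_mul, map_zsmul, map_one] at h
  refine IsUnit.of_mul_eq_one ((120 : ℝ)⁻¹ • (Int.castRingHom ℝ).mapMatrix toyChainAdj) ?_
  rw [mul_smul_comm, h, ← Int.cast_smul_eq_zsmul ℝ, smul_smul]
  norm_num

lemma isUnit_diagonal_sqrtBinom : IsUnit (diagonal sqrtBinom) := by
  rw [isUnit_diagonal, Pi.isUnit_iff]
  intro i
  fin_cases i <;> simp [sqrtBinom]

lemma Htoy_mul_diagonal :
    Htoy 0 0 * diagonal sqrtBinom =
      diagonal sqrtBinom * (Int.castRingHom ℝ).mapMatrix toyInt := by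
  have h2 : √2 * √2 = (2 : ℝ) := Real.mul_self_sqrt (by norm_num)
  have h5 : √5 * √5 = (5 : ℝ) := Real.mul_self_sqrt (by norm_num)
  ext i j
  rw [mul_diagonal, diagonal_mul]
  fin_cases i <;> fin_cases j <;> simp [Htoy, sqrtBinom, toyInt] <;> grind

lemma Htoy_pow_mul_diagonal (n : ℕ) :
    Htoy 0 0 ^ n * diagonal sqrtBinom =
      diagonal sqrtBinom * (Int.castRingHom ℝ).mapMatrix (toyInt ^ n) := by
  rw [map_pow]
  exact (SemiconjBy.pow_right (a := diagonal sqrtBinom) Htoy_mul_diagonal.symm n).symm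

lemma map_jordanInt :
    Complex.ofRealHom.mapMatrix ((Int.castRingHom ℝ).mapMatrix jordanInt) =
      jordanBlock 6 0 := by
  ext i j
  fin_cases i <;> fin_cases j <;> simp [jordanInt, jordanBlock]

/-- `H_toy(0,0)` realizes a sixth-order exceptional point of minimal geometric
multiplicity `K = 1`: it is similar to the single `6 × 6` Jordan block `J^{(6)}(0)`;
equivalently it is nilpotent with `H_toy(0,0)^6 = 0` and `H_toy(0,0)^5 ≠ 0`. -/
theorem stmt16 :
    (∃ Q : Matrix (Fin 6) (Fin 6) ℂ, IsUnit Q ∧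
      Q⁻¹ * (Htoy 0 0).map ((↑) : ℝ → ℂ) * Q = jordanBlock 6 0) ∧
    (Htoy 0 0)^6 = 0 ∧ (Htoy 0 0)^5 ≠ 0 := by
  refine ⟨?_, ?_, fun h => toyInt_pow_five ?_⟩
  · obtain ⟨P, hP, hHP⟩ : ∃ P : Matrix (Fin 6) (Fin 6) ℝ, IsUnit P ∧
        Htoy 0 0 * P = P * (Int.castRingHom ℝ).mapMatrix jordanInt := by
      refine ⟨_, isUnit_diagonal_sqrtBinom.mul isUnit_map_toyChain, ?_⟩
      rw [← mul_assoc, Htoy_mul_diagonal, mul_assoc, mul_assoc, ← map_mul, ← map_mul,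
        toyInt_mul_toyChain]
    have hQ : IsUnit (Complex.ofRealHom.mapMatrix P) := hP.map _
    refine ⟨_, hQ, ?_⟩
    change _ * Complex.ofRealHom.mapMatrix (Htoy 0 0) * _ = _
    rw [mul_assoc, ← map_mul, hHP, map_mul, map_jordanInt,
      nonsing_inv_mul_cancel_left _ _ ((isUnit_iff_isUnit_det _).mp hQ)]
  · rw [← isUnit_diagonal_sqrtBinom.mul_left_eq_zero, Htoy_pow_mul_diagonal, toyInt_pow_six,
      map_zero, mul_zero]
  · have h5 := Htoy_pow_mul_diagonal 5
    rw [h, zero_mul, eq_comm, isUnit_diagonal_sqrtBinom.mul_right_eq_zero] at h5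
    exact Matrix.map_injective Int.cast_injective (h5.trans (map_zero (Int.castRingHom ℝ).mapMatrix).symm)
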